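/- Let (H,A) be a compatible weak matched pair. Then for all a,x ∈ A and h ∈ H: x₁((h₁)⁰·1_A)·ε(a x₂ (h₁)¹ (h₂·1_A)) = x₁(h⁰·1_A)·ε(a x₂ h¹) in A. -/

import Mathlib

open TensorProduct

noncomputable section

namespace WeakSmash

variable (k : Type*) [Field k]

/-- A weak bialgebra structure on the `k`-algebra `H`. -/
structure WeakBialgebra (H : Type*) [Ring H] [Algebra k H] where
  comul : H →ₗ[k] H ⊗[k] H
  counit : H →ₗ[k] k
  coassoc : ∀ h : H,
    (TensorProduct.assoc k H H H) ((LinearMap.rTensor H comul) (comul h)) =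
      (LinearMap.lTensor H comul) (comul h)
  counit_comul : ∀ h : H,
    (TensorProduct.lid k H) ((LinearMap.rTensor H counit) (comul h)) = h
  comul_counit : ∀ h : H,
    (TensorProduct.rid k H) ((LinearMap.lTensor H counit) (comul h)) = h
  comul_mul : ∀ h g : H, comul (h * g) = comul h * comul g
  counit_weak : ∀ h g l : H,
    counit (h * g * l) =
      LinearMap.mul' k k
        ((TensorProduct.map (counit ∘ₗ LinearMap.mulLeft k h)
            (counit ∘ₗ LinearMap.mulRight k l)) (comul g))
  counit_weak' : ∀ h g l : H,
    counit (h * g * l) =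
      LinearMap.mul' k k
        ((TensorProduct.map (counit ∘ₗ LinearMap.mulLeft k h)
            (counit ∘ₗ LinearMap.mulRight k l)) ((TensorProduct.comm k H H) (comul g)))
  comul_one_left :
    ((TensorProduct.assoc k H H H) (comul 1 ⊗ₜ[k] (1 : H))) * ((1 : H) ⊗ₜ[k] comul 1) =
      (LinearMap.lTensor H comul) (comul 1)
  comul_one_right :
    ((1 : H) ⊗ₜ[k] comul 1) * ((TensorProduct.assoc k H H H) (comul 1 ⊗ₜ[k] (1 : H))) =
      (LinearMap.lTensor H comul) (comul 1)

variable {k}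

namespace WeakBialgebra

variable {H : Type*} [Ring H] [Algebra k H]

/-- The target counital map `εt h = ε(1₁ h) 1₂`. -/
def εt (W : WeakBialgebra k H) : H →ₗ[k] H :=
  (TensorProduct.lid k H).toLinearMap ∘ₗ LinearMap.rTensor H W.counit ∘ₗ
    LinearMap.mulLeft k (W.comul 1) ∘ₗ (TensorProduct.mk k H H).flip 1

/-- The source counital map `εs h = 1₁ ε(h 1₂)`. -/
def εs (W : WeakBialgebra k H) : H →ₗ[k] H :=
  (TensorProduct.rid k H).toLinearMap ∘ₗ LinearMap.lTensor H W.counit ∘ₗ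
    LinearMap.mulRight k (W.comul 1) ∘ₗ TensorProduct.mk k H H 1

/-- Cocommutativity of a weak bialgebra. -/
def Cocomm (W : WeakBialgebra k H) : Prop :=
  ∀ h : H, (TensorProduct.comm k H H) (W.comul h) = W.comul h

/-- `S` is an antipode for `W`, making it a weak Hopf algebra. -/
structure IsAntipode (W : WeakBialgebra k H) (S : H →ₗ[k] H) : Prop where
  mul_antipode : ∀ h : H,
    LinearMap.mul' k H ((LinearMap.lTensor H S) (W.comul h)) = W.εt h
  antipode_mul : ∀ h : H,
    LinearMap.mul' k H ((LinearMap.rTensor H S) (W.comul h)) = W.εs h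
  antipode_mid : ∀ h : H,
    LinearMap.mul' k H
      ((TensorProduct.map S (LinearMap.mul' k H ∘ₗ LinearMap.lTensor H S))
        ((LinearMap.lTensor H W.comul) (W.comul h))) = S h

/-- `α` is a left integral: `h α = εt(h) α`. -/
def IsLeftIntegral (W : WeakBialgebra k H) (α : H) : Prop :=
  ∀ h : H, h * α = W.εt h * α

end WeakBialgebra

section MatchedPair

variable (k)
variable {H A : Type*} [Ring H] [Algebra k H] [Ring A] [Algebra k A]

/-- `A` is a left `H`-module algebra via the action `act`. -/
structure IsModuleAlgebra (WH : WeakBialgebra k H) (act : H →ₗ[k] A →ₗ[k] A) : Prop where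
  one_act : ∀ a : A, act 1 a = a
  act_mul : ∀ (h : H) (a b : A),
    act h (a * b) =
      LinearMap.mul' k A ((TensorProduct.map (act.flip a) (act.flip b)) (WH.comul h))
  act_act : ∀ (h g : H) (a : A), act h (act g a) = act (h * g) a
  act_unit : ∀ h : H, act h 1 = act (WH.εt h) 1

/-- The map `h ↦ ε(h⁰) h¹`. -/
def coactCounit (WH : WeakBialgebra k H) (coact : H →ₗ[k] H ⊗[k] A) : H →ₗ[k] A :=
  (TensorProduct.lid k A).toLinearMap ∘ₗ LinearMap.rTensor A WH.counit ∘ₗ coact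

/-- `H` is a right `A`-comodule coalgebra via the coaction `coact`. -/
structure IsComoduleCoalgebra (WH : WeakBialgebra k H) (WA : WeakBialgebra k A)
    (coact : H →ₗ[k] H ⊗[k] A) : Prop where
  counit_coact : ∀ h : H,
    (TensorProduct.rid k H) ((LinearMap.lTensor H WA.counit) (coact h)) = h
  comul_coact : ∀ h : H,
    (LinearMap.rTensor A WH.comul) (coact h) =
      (LinearMap.lTensor (H ⊗[k] H) (LinearMap.mul' k A))
        ((TensorProduct.tensorTensorTensorComm k H A H A)
          ((TensorProduct.map coact coact) (WH.comul h)))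
  coact_coact : ∀ h : H,
    (TensorProduct.assoc k H A A) ((LinearMap.rTensor A coact) (coact h)) =
      (LinearMap.lTensor H WA.comul) (coact h)
  coact_counit : ∀ h : H,
    coactCounit k WH coact h = WA.εs (coactCounit k WH coact h)

/-- The map `(h₁ ⊗ h₂) ⊗ (x₁ ⊗ x₂) ↦ (h₁⁰ · x₁) ⊗ (h₁¹ (h₂ · x₂))`. -/
def pairMapA (act : H →ₗ[k] A →ₗ[k] A) (coact : H →ₗ[k] H ⊗[k] A) :
    (H ⊗[k] H) ⊗[k] (A ⊗[k] A) →ₗ[k] A ⊗[k] A :=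
  LinearMap.lTensor A (LinearMap.mul' k A) ∘ₗ
  (TensorProduct.assoc k A A A).toLinearMap ∘ₗ
  LinearMap.rTensor A
    (LinearMap.rTensor A (TensorProduct.lift act) ∘ₗ
      (TensorProduct.assoc k H A A).symm.toLinearMap ∘ₗ
      LinearMap.lTensor H (TensorProduct.comm k A A).toLinearMap ∘ₗ
      (TensorProduct.assoc k H A A).toLinearMap) ∘ₗ
  TensorProduct.map (LinearMap.rTensor A coact) (TensorProduct.lift act) ∘ₗ
  (TensorProduct.tensorTensorTensorComm k H H A A).toLinearMap

/-- The map `(h₁ ⊗ h₂) ⊗ (g⁰ ⊗ g¹) ↦ (h₁⁰ g⁰) ⊗ (h₁¹ (h₂ · g¹))`. -/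
def pairMapH (act : H →ₗ[k] A →ₗ[k] A) (coact : H →ₗ[k] H ⊗[k] A) :
    (H ⊗[k] H) ⊗[k] (H ⊗[k] A) →ₗ[k] H ⊗[k] A :=
  LinearMap.lTensor H (LinearMap.mul' k A) ∘ₗ
  (TensorProduct.assoc k H A A).toLinearMap ∘ₗ
  LinearMap.rTensor A
    (LinearMap.rTensor A (LinearMap.mul' k H) ∘ₗ
      (TensorProduct.assoc k H H A).symm.toLinearMap ∘ₗ
      LinearMap.lTensor H (TensorProduct.comm k A H).toLinearMap ∘ₗ
      (TensorProduct.assoc k H A H).toLinearMap) ∘ₗ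
  TensorProduct.map (LinearMap.rTensor H coact) (TensorProduct.lift act) ∘ₗ
  (TensorProduct.tensorTensorTensorComm k H H H A).toLinearMap

/-- The iterated comultiplication `h ↦ h₁ ⊗ (h₂ ⊗ h₃)`. -/
def twoComul (WH : WeakBialgebra k H) : H →ₗ[k] H ⊗[k] (H ⊗[k] H) :=
  LinearMap.lTensor H WH.comul ∘ₗ WH.comul

/-- The iterated comultiplication `h ↦ h₁ ⊗ (h₂ ⊗ (h₃ ⊗ h₄))`. -/
def threeComul (WH : WeakBialgebra k H) : H →ₗ[k] H ⊗[k] (H ⊗[k] (H ⊗[k] H)) :=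
  LinearMap.lTensor H (LinearMap.lTensor H WH.comul) ∘ₗ LinearMap.lTensor H WH.comul ∘ₗ WH.comul

/-- Left-hand side of the matched pair condition (iii):
`(h₁·x)₁ ⊗ (h₂ g)⁰ ⊗ (h₁·x)₂ (h₂ g)¹`. -/
def mpLHS (WH : WeakBialgebra k H) (WA : WeakBialgebra k A)
    (act : H →ₗ[k] A →ₗ[k] A) (coact : H →ₗ[k] H ⊗[k] A) (h g : H) (x : A) :
    (A ⊗[k] H) ⊗[k] A :=
  LinearMap.lTensor (A ⊗[k] H) (LinearMap.mul' k A)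
    ((TensorProduct.tensorTensorTensorComm k A A H A)
      ((TensorProduct.map (WA.comul ∘ₗ act.flip x) (coact ∘ₗ LinearMap.mulRight k g))
        (WH.comul h)))

/-- Right-hand side of the matched pair condition (iii):
`(h₁⁰ · x₁) ⊗ (h₃⁰ g⁰) ⊗ (h₁¹ (h₂ · x₂) h₃¹ (h₄ · g¹))`. -/
def mpRHS (WH : WeakBialgebra k H) (WA : WeakBialgebra k A)
    (act : H →ₗ[k] A →ₗ[k] A) (coact : H →ₗ[k] H ⊗[k] A) (h g : H) (x : A) :
    (A ⊗[k] H) ⊗[k] A :=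
  LinearMap.lTensor (A ⊗[k] H) (LinearMap.mul' k A)
    ((TensorProduct.tensorTensorTensorComm k A A H A)
      ((TensorProduct.map
          (pairMapA k act coact ∘ₗ
            (TensorProduct.mk k (H ⊗[k] H) (A ⊗[k] A)).flip (WA.comul x))
          (pairMapH k act coact ∘ₗ
            (TensorProduct.mk k (H ⊗[k] H) (H ⊗[k] A)).flip (coact g)))
        ((TensorProduct.assoc k H H (H ⊗[k] H)).symm (threeComul k WH h))))

/-- `(H, A)` is a weak matched pair. -/
structure IsWeakMatchedPair (WH : WeakBialgebra k H) (WA : WeakBialgebra k A)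
    (act : H →ₗ[k] A →ₗ[k] A) (coact : H →ₗ[k] H ⊗[k] A) : Prop where
  moduleAlgebra : IsModuleAlgebra k WH act
  comoduleCoalgebra : IsComoduleCoalgebra k WH WA coact
  cond3 : ∀ (h g : H) (x : A),
    mpLHS k WH WA act coact h g x = mpRHS k WH WA act coact h g x
  cond4 : ∀ (h : H) (x : A), WA.εs (act h x) = WA.εs (act h 1) * WA.εs x
  cond5 :
    (LinearMap.rTensor H coact) (WH.comul 1) =
      (TensorProduct.map (LinearMap.lTensor H (coactCounit k WH coact))
          (LinearMap.mul' k H))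
        ((TensorProduct.tensorTensorTensorComm k H H H H)
          (WH.comul 1 ⊗ₜ[k] WH.comul 1))

/-- `(H, A)` is a compatible (abelian) weak matched pair. -/
structure IsCompatiblePair (WH : WeakBialgebra k H) (WA : WeakBialgebra k A)
    (act : H →ₗ[k] A →ₗ[k] A) (coact : H →ₗ[k] H ⊗[k] A) : Prop where
  pair : IsWeakMatchedPair k WH WA act coact
  cocomm : WH.Cocomm
  comm : ∀ a b : A, a * b = b * a
  compat1 : ∀ h : H,
    act h 1 =
      (TensorProduct.rid k A)
        ((TensorProduct.map (TensorProduct.lift act)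
            (WA.counit ∘ₗ TensorProduct.lift act))
          ((TensorProduct.tensorTensorTensorComm k H H A A)
            (WH.comul h ⊗ₜ[k] WA.comul 1)))
  compat2 : ∀ h g : H,
    (TensorProduct.map (act h) (act g)) (WA.comul 1) =
      (TensorProduct.map (LinearMap.mulLeft k (act h 1))
        (LinearMap.mulLeft k (act g 1))) (WA.comul 1)

/-- The smash product multiplication on `A ⊗ H`:
`(x ⊗ h) (y ⊗ g) = x (h₁ · y) ⊗ h₂ g`. -/
def smashMul (WH : WeakBialgebra k H) (act : H →ₗ[k] A →ₗ[k] A) :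
    (A ⊗[k] H) ⊗[k] (A ⊗[k] H) →ₗ[k] A ⊗[k] H :=
  LinearMap.rTensor H (LinearMap.mul' k A) ∘ₗ
  (TensorProduct.assoc k A A H).symm.toLinearMap ∘ₗ
  LinearMap.lTensor A
    (TensorProduct.map (TensorProduct.lift act) (LinearMap.mul' k H) ∘ₗ
      (TensorProduct.tensorTensorTensorComm k H H A H).toLinearMap) ∘ₗ
  (TensorProduct.assoc k A (H ⊗[k] H) (A ⊗[k] H)).toLinearMap ∘ₗ
  LinearMap.rTensor (A ⊗[k] H) (LinearMap.lTensor A WH.comul)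

/-- The smash coproduct on `A ⊗ H`:
`Δ(x ⊗ h) = (x₁ ⊗ h₁⁰) ⊗ (x₂ h₁¹ ⊗ h₂)`. -/
def smashComul (WH : WeakBialgebra k H) (WA : WeakBialgebra k A)
    (coact : H →ₗ[k] H ⊗[k] A) :
    A ⊗[k] H →ₗ[k] (A ⊗[k] H) ⊗[k] (A ⊗[k] H) :=
  (TensorProduct.assoc k (A ⊗[k] H) A H).toLinearMap ∘ₗ
  LinearMap.rTensor H (LinearMap.lTensor (A ⊗[k] H) (LinearMap.mul' k A)) ∘ₗ
  LinearMap.rTensor H (TensorProduct.tensorTensorTensorComm k A A H A).toLinearMap ∘ₗ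
  (TensorProduct.assoc k (A ⊗[k] A) (H ⊗[k] A) H).symm.toLinearMap ∘ₗ
  LinearMap.lTensor (A ⊗[k] A) (LinearMap.rTensor H coact) ∘ₗ
  TensorProduct.map WA.comul WH.comul

/-- The smash counit `ε(x ⊗ h) = ε(x) ε(h)`. -/
def smashCounit (WH : WeakBialgebra k H) (WA : WeakBialgebra k A) :
    A ⊗[k] H →ₗ[k] k :=
  LinearMap.mul' k k ∘ₗ TensorProduct.map WA.counit WH.counit

/-- The projection `u ↦ u (1_A # 1_H)` onto `A ♯ H`. -/
def projUnder (WH : WeakBialgebra k H) (act : H →ₗ[k] A →ₗ[k] A) :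
    A ⊗[k] H →ₗ[k] A ⊗[k] H :=
  smashMul k WH act ∘ₗ
    (TensorProduct.mk k (A ⊗[k] H) (A ⊗[k] H)).flip ((1 : A) ⊗ₜ[k] (1 : H))

/-- The projection `u ↦ (id ⊗ ε) Δ(u)` onto `overline(A # H)`. -/
def projBar (WH : WeakBialgebra k H) (WA : WeakBialgebra k A)
    (coact : H →ₗ[k] H ⊗[k] A) : A ⊗[k] H →ₗ[k] A ⊗[k] H :=
  (TensorProduct.rid k (A ⊗[k] H)).toLinearMap ∘ₗ
    LinearMap.lTensor (A ⊗[k] H) (smashCounit k WH WA) ∘ₗ smashComul k WH WA coact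

/-- The projection onto `A ♯♯ H`, i.e. `u ↦ (id ⊗ ε) Δ (u (1#1))`. -/
def projBoth (WH : WeakBialgebra k H) (WA : WeakBialgebra k A)
    (act : H →ₗ[k] A →ₗ[k] A) (coact : H →ₗ[k] H ⊗[k] A) :
    A ⊗[k] H →ₗ[k] A ⊗[k] H :=
  projBar k WH WA coact ∘ₗ projUnder k WH act

/-- Componentwise smash multiplication on `(A⊗H) ⊗ (A⊗H)`. -/
def smashMul2 (WH : WeakBialgebra k H) (act : H →ₗ[k] A →ₗ[k] A) :
    ((A ⊗[k] H) ⊗[k] (A ⊗[k] H)) ⊗[k] ((A ⊗[k] H) ⊗[k] (A ⊗[k] H)) →ₗ[k]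
      (A ⊗[k] H) ⊗[k] (A ⊗[k] H) :=
  TensorProduct.map (smashMul k WH act) (smashMul k WH act) ∘ₗ
    (TensorProduct.tensorTensorTensorComm k (A ⊗[k] H) (A ⊗[k] H)
      (A ⊗[k] H) (A ⊗[k] H)).toLinearMap

/-- Componentwise smash multiplication on threefold tensors. -/
def smashMul3 (WH : WeakBialgebra k H) (act : H →ₗ[k] A →ₗ[k] A) :
    ((A ⊗[k] H) ⊗[k] ((A ⊗[k] H) ⊗[k] (A ⊗[k] H))) ⊗[k]
      ((A ⊗[k] H) ⊗[k] ((A ⊗[k] H) ⊗[k] (A ⊗[k] H))) →ₗ[k]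
      (A ⊗[k] H) ⊗[k] ((A ⊗[k] H) ⊗[k] (A ⊗[k] H)) :=
  TensorProduct.map (smashMul k WH act) (smashMul2 k WH act) ∘ₗ
    (TensorProduct.tensorTensorTensorComm k (A ⊗[k] H)
      ((A ⊗[k] H) ⊗[k] (A ⊗[k] H)) (A ⊗[k] H)
      ((A ⊗[k] H) ⊗[k] (A ⊗[k] H))).toLinearMap

/-- The unit element `1_A ♯♯ 1_H` of `A ♯♯ H`. -/
def smashOne (WH : WeakBialgebra k H) (WA : WeakBialgebra k A)
    (act : H →ₗ[k] A →ₗ[k] A) (coact : H →ₗ[k] H ⊗[k] A) : A ⊗[k] H :=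
  projBoth k WH WA act coact ((1 : A) ⊗ₜ[k] (1 : H))

/-- The map `εt` of the weak bialgebra `A ♯♯ H`: `u ↦ ε(e₁ u) e₂` where `e = 1_A ♯♯ 1_H`. -/
def smashEpsT (WH : WeakBialgebra k H) (WA : WeakBialgebra k A)
    (act : H →ₗ[k] A →ₗ[k] A) (coact : H →ₗ[k] H ⊗[k] A) (u : A ⊗[k] H) :
    A ⊗[k] H :=
  (TensorProduct.lid k (A ⊗[k] H))
    ((LinearMap.rTensor (A ⊗[k] H)
        (smashCounit k WH WA ∘ₗ smashMul k WH act ∘ₗ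
          (TensorProduct.mk k (A ⊗[k] H) (A ⊗[k] H)).flip u))
      (smashComul k WH WA coact (smashOne k WH WA act coact)))

/-- The map `εs` of the weak bialgebra `A ♯♯ H`: `u ↦ e₁ ε(u e₂)` where `e = 1_A ♯♯ 1_H`. -/
def smashEpsS (WH : WeakBialgebra k H) (WA : WeakBialgebra k A)
    (act : H →ₗ[k] A →ₗ[k] A) (coact : H →ₗ[k] H ⊗[k] A) (u : A ⊗[k] H) :
    A ⊗[k] H :=
  (TensorProduct.rid k (A ⊗[k] H))
    ((LinearMap.lTensor (A ⊗[k] H)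
        (smashCounit k WH WA ∘ₗ smashMul k WH act ∘ₗ
          TensorProduct.mk k (A ⊗[k] H) (A ⊗[k] H) u))
      (smashComul k WH WA coact (smashOne k WH WA act coact)))

/-- The antipode of `A ♯♯ H`:
`S(x ⊗ h) = (1_A ♯♯ S_H(h⁰)) ((S_A(x h¹)) ♯♯ 1_H)`. -/
def smashAntipode (WH : WeakBialgebra k H) (WA : WeakBialgebra k A)
    (act : H →ₗ[k] A →ₗ[k] A) (coact : H →ₗ[k] H ⊗[k] A)
    (SH : H →ₗ[k] H) (SA : A →ₗ[k] A) : A ⊗[k] H →ₗ[k] A ⊗[k] H :=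
  smashMul k WH act ∘ₗ
  TensorProduct.map
    (projBoth k WH WA act coact ∘ₗ TensorProduct.mk k A H 1)
    (projBoth k WH WA act coact ∘ₗ (TensorProduct.mk k A H).flip 1) ∘ₗ
  (TensorProduct.comm k A H).toLinearMap ∘ₗ
  TensorProduct.map (SA ∘ₗ LinearMap.mul' k A) SH ∘ₗ
  (TensorProduct.assoc k A A H).symm.toLinearMap ∘ₗ
  LinearMap.lTensor A ((TensorProduct.comm k H A).toLinearMap ∘ₗ coact)

/-- LHS of condition (7): `(1_{H1} h⁰ · 1_A) ⊗ S_A(h¹) εs(1_{H2}¹) ⊗ 1_{H2}⁰`. -/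
def cond7LHS (WH : WeakBialgebra k H) (WA : WeakBialgebra k A)
    (act : H →ₗ[k] A →ₗ[k] A) (coact : H →ₗ[k] H ⊗[k] A)
    (SA : A →ₗ[k] A) (h : H) : (A ⊗[k] A) ⊗[k] H :=
  (TensorProduct.assoc k A A H).symm
    ((TensorProduct.map
        (act.flip 1 ∘ₗ LinearMap.mul' k H)
        ((TensorProduct.comm k H A).toLinearMap ∘ₗ
          LinearMap.lTensor H
            (LinearMap.mul' k A ∘ₗ TensorProduct.map SA WA.εs ∘ₗ
              (TensorProduct.comm k A A).toLinearMap) ∘ₗ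
          (TensorProduct.assoc k H A A).toLinearMap ∘ₗ
          LinearMap.rTensor A coact))
      ((TensorProduct.tensorTensorTensorComm k H H H A)
        (WH.comul 1 ⊗ₜ[k] coact h)))

/-- RHS of condition (7):
`εt(1_{H1}⁰ h⁰ · 1_A) ⊗ εt(h¹) εs(1_{H2}¹) 1_{H1}¹ ⊗ 1_{H2}⁰`. -/
def cond7RHS (WH : WeakBialgebra k H) (WA : WeakBialgebra k A)
    (act : H →ₗ[k] A →ₗ[k] A) (coact : H →ₗ[k] H ⊗[k] A) (h : H) :
    (A ⊗[k] A) ⊗[k] H :=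
  (TensorProduct.assoc k A A H).symm
   ((LinearMap.lTensor A (TensorProduct.comm k H A).toLinearMap)
    ((TensorProduct.assoc k A H A)
     ((LinearMap.lTensor (A ⊗[k] H)
        (LinearMap.mul' k A ∘ₗ (TensorProduct.comm k A A).toLinearMap))
      ((TensorProduct.tensorTensorTensorComm k A A H A)
       ((LinearMap.lTensor (A ⊗[k] A) (TensorProduct.comm k A H).toLinearMap)
        ((TensorProduct.map
            (LinearMap.rTensor A (WA.εt ∘ₗ act.flip 1 ∘ₗ LinearMap.mul' k H) ∘ₗ
              (TensorProduct.assoc k H H A).symm.toLinearMap ∘ₗ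
              LinearMap.lTensor H (TensorProduct.comm k A H).toLinearMap ∘ₗ
              (TensorProduct.assoc k H A H).toLinearMap)
            (LinearMap.rTensor H
                (LinearMap.mul' k A ∘ₗ (TensorProduct.comm k A A).toLinearMap ∘ₗ
                  TensorProduct.map WA.εs WA.εt) ∘ₗ
              (TensorProduct.assoc k A A H).symm.toLinearMap ∘ₗ
              LinearMap.lTensor A (TensorProduct.comm k H A).toLinearMap ∘ₗ
              (TensorProduct.assoc k A H A).toLinearMap ∘ₗ
              LinearMap.rTensor A (TensorProduct.comm k H A).toLinearMap))
          ((TensorProduct.tensorTensorTensorComm k (H ⊗[k] A) (H ⊗[k] A) H A)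
            (((TensorProduct.map coact coact) (WH.comul 1)) ⊗ₜ[k] coact h))))))))

/-- LHS of condition (8):
`εs(h₁¹ h₂¹) (S_H(h₁⁰) · 1_A) ⊗ S_H(h₂⁰) h₃`. -/
def cond8LHS (WH : WeakBialgebra k H) (WA : WeakBialgebra k A)
    (act : H →ₗ[k] A →ₗ[k] A) (coact : H →ₗ[k] H ⊗[k] A)
    (SH : H →ₗ[k] H) (h : H) : A ⊗[k] H :=
  LinearMap.rTensor H (LinearMap.mul' k A)
   ((TensorProduct.assoc k A A H).symm
    ((TensorProduct.map
        (WA.εs ∘ₗ LinearMap.mul' k A)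
        (TensorProduct.map (act.flip 1 ∘ₗ SH)
          (LinearMap.mul' k H ∘ₗ LinearMap.rTensor H SH)))
      ((TensorProduct.tensorTensorTensorComm k A H A (H ⊗[k] H))
        ((TensorProduct.map (TensorProduct.comm k H A).toLinearMap
            ((TensorProduct.assoc k A H H).toLinearMap ∘ₗ
              LinearMap.rTensor H (TensorProduct.comm k H A).toLinearMap))
          ((TensorProduct.map coact (LinearMap.rTensor H coact))
            (twoComul k WH h))))))

/-- RHS of condition (8):
`εs(h¹ 1_{H2}¹) εs(h⁰ 1_{H1} · 1_A) ⊗ 1_{H2}⁰`. -/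
def cond8RHS (WH : WeakBialgebra k H) (WA : WeakBialgebra k A)
    (act : H →ₗ[k] A →ₗ[k] A) (coact : H →ₗ[k] H ⊗[k] A) (h : H) :
    A ⊗[k] H :=
  LinearMap.rTensor H (LinearMap.mul' k A ∘ₗ (TensorProduct.comm k A A).toLinearMap)
   ((TensorProduct.assoc k A A H).symm
    ((TensorProduct.map
        (WA.εs ∘ₗ act.flip 1 ∘ₗ LinearMap.mul' k H)
        (LinearMap.rTensor H (WA.εs ∘ₗ LinearMap.mul' k A) ∘ₗ
          (TensorProduct.assoc k A A H).symm.toLinearMap ∘ₗ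
          LinearMap.lTensor A (TensorProduct.comm k H A).toLinearMap))
      ((TensorProduct.tensorTensorTensorComm k H A H (H ⊗[k] A))
        (coact h ⊗ₜ[k] (LinearMap.lTensor H coact) (WH.comul 1)))))

/-- The element `εs(t₁¹ (t₂ · 1_A)) ⊗ t₁⁰` of `A ⊗ H`. -/
def integralWitness (WH : WeakBialgebra k H) (WA : WeakBialgebra k A)
    (act : H →ₗ[k] A →ₗ[k] A) (coact : H →ₗ[k] H ⊗[k] A) (t : H) :
    A ⊗[k] H :=
  (TensorProduct.comm k H A)
    ((LinearMap.lTensor H (WA.εs ∘ₗ LinearMap.mul' k A))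
      ((TensorProduct.assoc k H A A)
        ((LinearMap.rTensor A coact)
          ((LinearMap.lTensor H (act.flip 1)) (WH.comul t)))))

end MatchedPair

end WeakSmash


namespace WeakSmash

namespace WeakBialgebra

variable {k H A V : Type*} [Field k] [Ring H] [Algebra k H] [Ring A] [Algebra k A]
  [AddCommGroup V] [Module k V]

/-- The convolution product of two linear maps `H → A`. -/
def conv (W : WeakBialgebra k H) (f g : H →ₗ[k] A) : H →ₗ[k] A :=
  LinearMap.mul' k A ∘ₗ TensorProduct.map f g ∘ₗ W.comul

theorem conv_assoc (W : WeakBialgebra k H) (f g l : H →ₗ[k] A) :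
    W.conv (W.conv f g) l = W.conv f (W.conv g l) := by
  ext h
  have key := congrArg (LinearMap.mul' k A ∘ₗ
    TensorProduct.map f (LinearMap.mul' k A ∘ₗ TensorProduct.map g l)) (W.coassoc h)
  have hl : ∀ t : H ⊗[k] H, LinearMap.mul' k A (TensorProduct.map (W.conv f g) l t) =
      (LinearMap.mul' k A ∘ₗ TensorProduct.map f (LinearMap.mul' k A ∘ₗ TensorProduct.map g l))
        ((TensorProduct.assoc k H H H) ((LinearMap.rTensor H W.comul) t)) := by
    intro t
    induction t with
    | zero => simp
    | add s t hs ht => simp only [map_add, hs, ht]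
    | tmul p q =>
      simp only [conv, TensorProduct.map_tmul, LinearMap.rTensor_tmul, LinearMap.comp_apply,
        LinearMap.mul'_apply]
      induction W.comul p with
      | zero => simp
      | add s t hs ht => simp only [map_add, add_mul, TensorProduct.add_tmul, hs, ht]
      | tmul u v => simp [mul_assoc]
  have hr : ∀ t : H ⊗[k] H, LinearMap.mul' k A (TensorProduct.map f (W.conv g l) t) =
      (LinearMap.mul' k A ∘ₗ TensorProduct.map f (LinearMap.mul' k A ∘ₗ TensorProduct.map g l))
        ((LinearMap.lTensor H W.comul) t) := by
    intro t
    induction t with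
    | zero => simp
    | add s t hs ht => simp only [map_add, hs, ht]
    | tmul p q => simp [conv]
  exact (hl _).trans (key.trans (hr _).symm)

theorem conv_comm (W : WeakBialgebra k H) (hW : W.Cocomm) (hA : ∀ a b : A, a * b = b * a)
    (f g : H →ₗ[k] A) : W.conv f g = W.conv g f := by
  ext h
  have key : ∀ t : H ⊗[k] H, LinearMap.mul' k A (TensorProduct.map f g t) =
      LinearMap.mul' k A (TensorProduct.map g f ((TensorProduct.comm k H H) t)) := by
    intro t
    induction t with
    | zero => simp
    | add s t hs ht => simp only [map_add, hs, ht]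
    | tmul p q => simp [hA (f p)]
  have := key (W.comul h)
  rwa [hW h] at this

/-- For a linear map `ρ : V → V ⊗ A`, the operator `v ↦ v⁰ ε(y v¹)`. -/
def dualAct (W : WeakBialgebra k A) (ρ : V →ₗ[k] V ⊗[k] A) (y : A) : V →ₗ[k] V :=
  (TensorProduct.rid k V).toLinearMap ∘ₗ
    LinearMap.lTensor V (W.counit ∘ₗ LinearMap.mulLeft k y) ∘ₗ ρ

/-- If `ρ` is coassociative, then `dualAct` is an action of a commutative `A`. -/
theorem dualAct_dualAct (W : WeakBialgebra k A) (hA : ∀ a b : A, a * b = b * a)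
    (ρ : V →ₗ[k] V ⊗[k] A)
    (hρ : ∀ v : V, (TensorProduct.assoc k V A A) ((LinearMap.rTensor A ρ) (ρ v)) =
      (LinearMap.lTensor V W.comul) (ρ v)) (y z : A) (v : V) :
    W.dualAct ρ y (W.dualAct ρ z v) = W.dualAct ρ (y * z) v := by
  let G : V ⊗[k] (A ⊗[k] A) →ₗ[k] V := (TensorProduct.rid k V).toLinearMap ∘ₗ
    LinearMap.lTensor V (LinearMap.mul' k k ∘ₗ TensorProduct.map
      (W.counit ∘ₗ LinearMap.mulLeft k y) (W.counit ∘ₗ LinearMap.mulLeft k z))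
  have hl : ∀ t : V ⊗[k] A, W.dualAct ρ y ((TensorProduct.rid k V)
      (LinearMap.lTensor V (W.counit ∘ₗ LinearMap.mulLeft k z) t)) =
      G ((TensorProduct.assoc k V A A) ((LinearMap.rTensor A ρ) t)) := by
    intro t
    induction t with
    | zero => simp
    | add s t hs ht => simp only [map_add, hs, ht]
    | tmul p q =>
      simp only [dualAct, LinearMap.comp_apply, LinearMap.lTensor_tmul, LinearMap.rTensor_tmul,
        TensorProduct.rid_tmul, map_smul, LinearEquiv.coe_coe]
      induction ρ p with
      | zero => simp
      | add s t hs ht => simp only [map_add, smul_add, TensorProduct.add_tmul, hs, ht]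
      | tmul u v => simp [G, smul_smul, mul_comm]
  have hr : ∀ t : V ⊗[k] A, (TensorProduct.rid k V)
      (LinearMap.lTensor V (W.counit ∘ₗ LinearMap.mulLeft k (y * z)) t) =
      G ((LinearMap.lTensor V W.comul) t) := by
    intro t
    induction t with
    | zero => simp
    | add s t hs ht => simp only [map_add, hs, ht]
    | tmul p q =>
      have hz : LinearMap.mulRight k z = LinearMap.mulLeft k z := by
        ext b
        simp [hA b z]
      have hq : y * z * q = y * q * z := by rw [mul_assoc, hA z, mul_assoc]
      simp only [G, LinearMap.lTensor_tmul, LinearMap.comp_apply, TensorProduct.rid_tmul,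
        LinearEquiv.coe_coe, LinearMap.mulLeft_apply, hq, W.counit_weak y q z, hz]
  exact (hl _).trans ((congrArg G (hρ v)).trans (hr _).symm)

theorem εs_eq_sum (W : WeakBialgebra k A) {S : Finset (A × A)}
    (hS : W.comul 1 = ∑ i ∈ S, i.1 ⊗ₜ[k] i.2) (c : A) :
    W.εs c = ∑ i ∈ S, W.counit (c * i.2) • i.1 := by
  simp [εs, hS, Finset.mul_sum]

theorem counit_mul_eq_sum (W : WeakBialgebra k A) {S : Finset (A × A)}
    (hS : W.comul 1 = ∑ i ∈ S, i.1 ⊗ₜ[k] i.2) (a b : A) :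
    W.counit (a * b) = ∑ i ∈ S, W.counit (a * i.1) * W.counit (i.2 * b) := by
  simpa [hS] using W.counit_weak a 1 b

/-- In a commutative weak bialgebra, `x₁ ε(c x₂) = x εs(c)`. -/
theorem dualAct_comul (W : WeakBialgebra k A) (hA : ∀ a b : A, a * b = b * a) (c x : A) :
    W.dualAct W.comul c x = x * W.εs c := by
  obtain ⟨S, hS⟩ := TensorProduct.exists_finset (W.comul 1)
  let G : A ⊗[k] (A ⊗[k] A) →ₗ[k] A := (TensorProduct.rid k A).toLinearMap ∘ₗ
    LinearMap.lTensor A (LinearMap.mul' k k ∘ₗ TensorProduct.map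
      W.counit (W.counit ∘ₗ LinearMap.mulLeft k c))
  have hmul : ∀ t s : A ⊗[k] A, (TensorProduct.assoc k A A A) (t ⊗ₜ[k] (1 : A)) *
      (TensorProduct.assoc k A A A) (s ⊗ₜ[k] (1 : A)) =
      (TensorProduct.assoc k A A A) ((t * s) ⊗ₜ[k] (1 : A)) := fun t s => by
    have := (map_mul (Algebra.TensorProduct.assoc k k k A A A) (t ⊗ₜ[k] (1 : A))
      (s ⊗ₜ[k] (1 : A))).symm
    rwa [Algebra.TensorProduct.tmul_mul_tmul, mul_one] at this
  have hl : ∀ t : A ⊗[k] A, (TensorProduct.rid k A)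
      (LinearMap.lTensor A (W.counit ∘ₗ LinearMap.mulLeft k c) t) =
      G ((TensorProduct.assoc k A A A) (t ⊗ₜ[k] (1 : A)) * ((1 : A) ⊗ₜ[k] W.comul 1)) := by
    intro t
    induction t with
    | zero => simp
    | add s t hs ht => simp only [map_add, add_mul, TensorProduct.add_tmul, hs, ht]
    | tmul p q =>
      simp [G, hS, Finset.mul_sum, TensorProduct.tmul_sum, hA c, W.counit_mul_eq_sum hS q c]
  have hr : ∀ t : A ⊗[k] A, G ((TensorProduct.assoc k A A A) (W.comul x ⊗ₜ[k] (1 : A)) *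
      (TensorProduct.assoc k A A A) ((LinearMap.rTensor A W.comul) t)) =
      x * (TensorProduct.rid k A) (LinearMap.lTensor A (W.counit ∘ₗ LinearMap.mulLeft k c) t) := by
    intro t
    induction t with
    | zero => simp
    | add s t hs ht => simp only [map_add, mul_add, hs, ht]
    | tmul p q =>
      have h1 : (TensorProduct.assoc k A A A) (W.comul x ⊗ₜ[k] (1 : A)) *
          (TensorProduct.assoc k A A A) (W.comul p ⊗ₜ[k] q) =
          (TensorProduct.assoc k A A A) (W.comul (x * p) ⊗ₜ[k] q) := by
        have := (map_mul (Algebra.TensorProduct.assoc k k k A A A) (W.comul x ⊗ₜ[k] (1 : A))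
          (W.comul p ⊗ₜ[k] q)).symm
        rwa [Algebra.TensorProduct.tmul_mul_tmul, one_mul, ← W.comul_mul] at this
      have h2 : ∀ s : A ⊗[k] A, G ((TensorProduct.assoc k A A A) (s ⊗ₜ[k] q)) =
          W.counit (c * q) • (TensorProduct.rid k A) (LinearMap.lTensor A W.counit s) := by
        intro s
        induction s with
        | zero => simp
        | add s t hs ht => simp only [map_add, smul_add, TensorProduct.add_tmul, hs, ht]
        | tmul u v => simp [G, smul_smul, mul_comm]
      rw [LinearMap.rTensor_tmul, h1, h2, W.comul_counit]
      simp
  have hεs : W.εs c = (TensorProduct.rid k A)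
      (LinearMap.lTensor A (W.counit ∘ₗ LinearMap.mulLeft k c) (W.comul 1)) := by
    simp [W.εs_eq_sum hS, hS]
  have hx : W.comul x * W.comul 1 = W.comul x := by rw [← W.comul_mul, mul_one]
  rw [hεs, ← hr, W.coassoc, ← W.comul_one_left, ← mul_assoc, hmul, hx, ← hl]
  rfl

theorem dualAct_comul_mul (W : WeakBialgebra k A) (hA : ∀ a b : A, a * b = b * a) (c d x : A) :
    W.dualAct W.comul (c * d) x = x * W.εs d * W.εs c := by
  rw [← W.dualAct_dualAct hA _ W.coassoc, W.dualAct_comul hA, W.dualAct_comul hA]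

/-- In a commutative weak bialgebra, `εs` is multiplicative. -/
theorem εs_mul (W : WeakBialgebra k A) (hA : ∀ a b : A, a * b = b * a) (c d : A) :
    W.εs (c * d) = W.εs c * W.εs d := by
  have h1 := W.dualAct_comul hA (c * d) 1
  rw [W.dualAct_comul_mul hA, one_mul, one_mul] at h1
  rw [← h1, hA]

end WeakBialgebra

section Comodule

variable {k H A : Type*} [Field k] [Ring H] [Algebra k H] [Ring A] [Algebra k A]
  {WH : WeakBialgebra k H} {WA : WeakBialgebra k A} {coact : H →ₗ[k] H ⊗[k] A}

theorem IsComoduleCoalgebra.comul_dualAct_eq_sum (hC : IsComoduleCoalgebra k WH WA coact)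
    (hA : ∀ a b : A, a * b = b * a) {S : Finset (A × A)}
    (hS : WA.comul 1 = ∑ i ∈ S, i.1 ⊗ₜ[k] i.2) (y : A) (h : H) :
    WH.comul (WA.dualAct coact y h) = ∑ i ∈ S, TensorProduct.map (WA.dualAct coact i.1)
      (WA.dualAct coact (y * i.2)) (WH.comul h) := by
  let G : (H ⊗[k] H) ⊗[k] A →ₗ[k] H ⊗[k] H := (TensorProduct.rid k (H ⊗[k] H)).toLinearMap ∘ₗ
    LinearMap.lTensor (H ⊗[k] H) (WA.counit ∘ₗ LinearMap.mulLeft k y)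
  have hl : ∀ t : H ⊗[k] A, WH.comul ((TensorProduct.rid k H)
      (LinearMap.lTensor H (WA.counit ∘ₗ LinearMap.mulLeft k y) t)) =
      G ((LinearMap.rTensor A WH.comul) t) := by
    intro t
    induction t with
    | zero => simp
    | add s t hs ht => simp only [map_add, hs, ht]
    | tmul p q => simp [G]
  have hr : ∀ t s : H ⊗[k] A, G ((LinearMap.lTensor (H ⊗[k] H) (LinearMap.mul' k A))
      ((TensorProduct.tensorTensorTensorComm k H A H A) (t ⊗ₜ[k] s))) =
      ∑ i ∈ S, (TensorProduct.rid k H)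
          (LinearMap.lTensor H (WA.counit ∘ₗ LinearMap.mulLeft k i.1) t) ⊗ₜ[k]
        (TensorProduct.rid k H)
          (LinearMap.lTensor H (WA.counit ∘ₗ LinearMap.mulLeft k (y * i.2)) s) := by
    intro t s
    induction t with
    | zero => simp
    | add t t' h1 h2 =>
      simp only [map_add, TensorProduct.add_tmul, h1, h2, Finset.sum_add_distrib]
    | tmul p q =>
      induction s with
      | zero => simp
      | add t t' h1 h2 =>
        simp only [map_add, TensorProduct.tmul_add, h1, h2, Finset.sum_add_distrib]
      | tmul u v =>
        have hq : WA.counit (y * (q * v)) =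
            ∑ i ∈ S, WA.counit (i.1 * q) * WA.counit (y * i.2 * v) := by
          rw [← mul_assoc, hA y q, mul_assoc, WA.counit_mul_eq_sum hS]
          refine Finset.sum_congr rfl fun i _ => ?_
          rw [hA q, ← mul_assoc, hA i.2]
        simp only [G, TensorProduct.tensorTensorTensorComm_tmul, LinearMap.lTensor_tmul,
          LinearMap.mul'_apply, LinearMap.comp_apply, TensorProduct.rid_tmul, LinearEquiv.coe_coe,
          LinearMap.mulLeft_apply, hq, Finset.sum_smul, TensorProduct.smul_tmul_smul]
  have hs : ∀ t : H ⊗[k] H, G ((LinearMap.lTensor (H ⊗[k] H) (LinearMap.mul' k A))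
      ((TensorProduct.tensorTensorTensorComm k H A H A)
        ((TensorProduct.map coact coact) t))) =
      ∑ i ∈ S, TensorProduct.map (WA.dualAct coact i.1) (WA.dualAct coact (y * i.2)) t := by
    intro t
    induction t with
    | zero => simp
    | add t t' h1 h2 => simp only [map_add, h1, h2, Finset.sum_add_distrib]
    | tmul p q => exact hr (coact p) (coact q)
  rw [← hs, ← hC.comul_coact, ← hl]
  rfl

/-- `h₁ ⊗ (h₂)⁰ ε(y (h₂)¹) = Δ(h⁰) ε(y h¹)`. -/
theorem IsComoduleCoalgebra.comul_dualAct (hC : IsComoduleCoalgebra k WH WA coact)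
    (hA : ∀ a b : A, a * b = b * a) (y : A) (h : H) :
    WH.comul (WA.dualAct coact y h) =
      LinearMap.lTensor H (WA.dualAct coact y) (WH.comul h) := by
  obtain ⟨S, hS⟩ := TensorProduct.exists_finset (WA.comul 1)
  have h1 : WA.dualAct coact 1 h = h := by
    have hm : LinearMap.mulLeft k (1 : A) = LinearMap.id := by ext; simp
    have := hC.counit_coact h
    simpa [WeakBialgebra.dualAct, hm] using this
  have hone := hC.comul_dualAct_eq_sum hA hS 1 h
  rw [h1] at hone
  rw [hC.comul_dualAct_eq_sum hA hS y h]
  refine Eq.trans ?_ ((congrArg _ hone).trans (map_sum _ _ _)).symm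
  refine Finset.sum_congr rfl fun i _ => ?_
  have hcomp : WA.dualAct coact (y * i.2) =
      WA.dualAct coact y ∘ₗ WA.dualAct coact (1 * i.2) := by
    ext g
    rw [one_mul, LinearMap.comp_apply, WA.dualAct_dualAct hA coact hC.coact_coact]
  rw [hcomp, ← LinearMap.lTensor_comp_map]
  rfl

/-- `h⁰ ε(y h¹) = h₁ ε((h₂)⁰) ε(y (h₂)¹)`. -/
theorem IsComoduleCoalgebra.dualAct_eq (hC : IsComoduleCoalgebra k WH WA coact)
    (hA : ∀ a b : A, a * b = b * a) (y : A) (h : H) :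
    WA.dualAct coact y h = (TensorProduct.rid k H)
      (LinearMap.lTensor H (WH.counit ∘ₗ WA.dualAct coact y) (WH.comul h)) := by
  rw [LinearMap.lTensor_comp, LinearMap.comp_apply, ← hC.comul_dualAct hA, WH.comul_counit]

/-- The map `h ↦ f(h⁰) εs(h¹)` is a left convolution multiple of `f`. -/
theorem IsComoduleCoalgebra.exists_conv_eq (hC : IsComoduleCoalgebra k WH WA coact)
    (hA : ∀ a b : A, a * b = b * a) :
    ∃ θ : H →ₗ[k] A, ∀ f : H →ₗ[k] A,
      LinearMap.mul' k A ∘ₗ TensorProduct.map f WA.εs ∘ₗ coact = WH.conv f θ := by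
  obtain ⟨S, hS⟩ := TensorProduct.exists_finset (WA.comul 1)
  refine ⟨∑ i ∈ S, (WH.counit ∘ₗ WA.dualAct coact i.2).smulRight i.1, fun f => ?_⟩
  ext h
  have hl : ∀ t : H ⊗[k] A, LinearMap.mul' k A (TensorProduct.map f WA.εs t) =
      ∑ i ∈ S, f ((TensorProduct.rid k H)
        (LinearMap.lTensor H (WA.counit ∘ₗ LinearMap.mulLeft k i.2) t)) * i.1 := by
    intro t
    induction t with
    | zero => simp
    | add t t' h1 h2 => simp only [map_add, add_mul, h1, h2, Finset.sum_add_distrib]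
    | tmul p q => simp [WA.εs_eq_sum hS, Finset.mul_sum, hA q]
  have hr : ∀ t : H ⊗[k] H, LinearMap.mul' k A (TensorProduct.map f
        (∑ i ∈ S, (WH.counit ∘ₗ WA.dualAct coact i.2).smulRight i.1) t) =
      ∑ i ∈ S, f ((TensorProduct.rid k H)
        (LinearMap.lTensor H (WH.counit ∘ₗ WA.dualAct coact i.2) t)) * i.1 := by
    intro t
    induction t with
    | zero => simp
    | add t t' h1 h2 => simp only [map_add, add_mul, h1, h2, Finset.sum_add_distrib]
    | tmul p q => simp [Finset.mul_sum, LinearMap.sum_apply]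
  refine (hl _).trans (Eq.trans ?_ (hr _).symm)
  refine Finset.sum_congr rfl fun i _ => ?_
  rw [← hC.dualAct_eq hA]
  rfl

end Comodule

section Compatible

variable {k H A : Type*} [Field k] [Ring H] [Algebra k H] [Ring A] [Algebra k A]
  {WH : WeakBialgebra k H} {WA : WeakBialgebra k A}
  {act : H →ₗ[k] A →ₗ[k] A} {coact : H →ₗ[k] H ⊗[k] A}

/-- `h · 1 = (h₁ · 1) εs(h₂ · 1)`. -/
theorem IsCompatiblePair.conv_act_one (hCP : IsCompatiblePair k WH WA act coact) :
    WH.conv (act.flip 1) (WA.εs ∘ₗ act.flip 1) = act.flip 1 := by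
  obtain ⟨S, hS⟩ := TensorProduct.exists_finset (WA.comul 1)
  ext h
  rw [LinearMap.flip_apply, hCP.compat1 h]
  change LinearMap.mul' k A (TensorProduct.map (act.flip 1) (WA.εs ∘ₗ act.flip 1) (WH.comul h)) = _
  induction WH.comul h with
  | zero => simp
  | add t t' h1 h2 => simp only [map_add, TensorProduct.add_tmul, h1, h2]
  | tmul p q =>
    have h1 : ∀ s : A ⊗[k] A, (TensorProduct.rid k A)
        ((TensorProduct.map (TensorProduct.lift act) (WA.counit ∘ₗ TensorProduct.lift act))
          ((TensorProduct.tensorTensorTensorComm k H H A A) ((p ⊗ₜ[k] q) ⊗ₜ[k] s))) =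
        (TensorProduct.rid k A) (LinearMap.lTensor A WA.counit
          (TensorProduct.map (act p) (act q) s)) := by
      intro s
      induction s with
      | zero => simp
      | add t t' h1 h2 => simp only [map_add, TensorProduct.tmul_add, h1, h2]
      | tmul u v => simp
    rw [h1, hCP.compat2]
    simp [hS, WA.εs_eq_sum hS, Finset.mul_sum]

theorem counit_contract_eq (hA : ∀ a b : A, a * b = b * a) (a x : A) (t : A ⊗[k] A) :
    (TensorProduct.rid k A) ((TensorProduct.map (LinearMap.mul' k A)
        (WA.counit ∘ₗ LinearMap.mulLeft k a ∘ₗ LinearMap.mul' k A))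
      ((TensorProduct.tensorTensorTensorComm k A A A A) (WA.comul x ⊗ₜ[k] t))) =
      x * WA.εs a * LinearMap.mul' k A (TensorProduct.map LinearMap.id WA.εs t) := by
  induction t with
  | zero => simp
  | add t t' h1 h2 => simp only [map_add, TensorProduct.tmul_add, mul_add, h1, h2]
  | tmul p q =>
    have h1 : ∀ s : A ⊗[k] A, (TensorProduct.rid k A) ((TensorProduct.map (LinearMap.mul' k A)
        (WA.counit ∘ₗ LinearMap.mulLeft k a ∘ₗ LinearMap.mul' k A))
        ((TensorProduct.tensorTensorTensorComm k A A A A) (s ⊗ₜ[k] (p ⊗ₜ[k] q)))) =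
        (TensorProduct.rid k A)
          (LinearMap.lTensor A (WA.counit ∘ₗ LinearMap.mulLeft k (q * a)) s) * p := by
      intro s
      induction s with
      | zero => simp
      | add t t' h1 h2 => simp only [map_add, TensorProduct.add_tmul, add_mul, h1, h2]
      | tmul u v =>
        have : a * (v * q) = q * a * v := by rw [hA v, ← mul_assoc, hA a]
        simp [this, mul_assoc]
    have h2 := WA.dualAct_comul_mul hA q a x
    rw [h1]
    refine (congrArg (· * p) h2).trans ?_
    simp [mul_assoc, hA p]

end Compatible

theorem triangle_lemma
    {k H A : Type*} [Field k] [Ring H] [Algebra k H] [Ring A] [Algebra k A]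
    (WH : WeakBialgebra k H) (WA : WeakBialgebra k A)
    (act : H →ₗ[k] A →ₗ[k] A) (coact : H →ₗ[k] H ⊗[k] A)
    (hCP : IsCompatiblePair k WH WA act coact) :
    ∀ (a x : A) (h : H),
      (TensorProduct.rid k A)
          ((TensorProduct.map (LinearMap.mul' k A)
              (WA.counit ∘ₗ LinearMap.mulLeft k a ∘ₗ LinearMap.mul' k A))
            ((TensorProduct.tensorTensorTensorComm k A A A A)
              (WA.comul x ⊗ₜ[k]
                ((LinearMap.rTensor A (act.flip 1))
                  ((LinearMap.lTensor H (LinearMap.mul' k A))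
                    ((LinearMap.lTensor H (LinearMap.lTensor A (act.flip 1)))
                      ((TensorProduct.assoc k H A H)
                        ((LinearMap.rTensor H coact) (WH.comul h))))))))) =
        (TensorProduct.rid k A)
          ((TensorProduct.map (LinearMap.mul' k A)
              (WA.counit ∘ₗ LinearMap.mulLeft k a ∘ₗ LinearMap.mul' k A))
            ((TensorProduct.tensorTensorTensorComm k A A A A)
              (WA.comul x ⊗ₜ[k] (LinearMap.rTensor A (act.flip 1)) (coact h)))) := by
  intro a x h
  have hA := hCP.comm
  obtain ⟨θ, hθ⟩ := hCP.pair.comoduleCoalgebra.exists_conv_eq hA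
  rw [counit_contract_eq hA, counit_contract_eq hA]
  congr 1
  have hr : LinearMap.mul' k A (TensorProduct.map LinearMap.id WA.εs
      ((LinearMap.rTensor A (act.flip 1)) (coact h))) = WH.conv (act.flip 1) θ h := by
    rw [← hθ, LinearMap.rTensor, ← LinearMap.comp_apply (TensorProduct.map _ _),
      ← TensorProduct.map_comp]
    rfl
  have hl : ∀ t : H ⊗[k] H, LinearMap.mul' k A (TensorProduct.map LinearMap.id WA.εs
      ((LinearMap.rTensor A (act.flip 1)) ((LinearMap.lTensor H (LinearMap.mul' k A))
        ((LinearMap.lTensor H (LinearMap.lTensor A (act.flip 1)))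
          ((TensorProduct.assoc k H A H) ((LinearMap.rTensor H coact) t)))))) =
      LinearMap.mul' k A (TensorProduct.map (WH.conv (act.flip 1) θ) (WA.εs ∘ₗ act.flip 1) t) := by
    intro t
    induction t with
    | zero => simp
    | add t t' h1 h2 => simp only [map_add, h1, h2]
    | tmul p q =>
      rw [← hθ]
      simp only [LinearMap.rTensor_tmul, TensorProduct.map_tmul, LinearMap.mul'_apply,
        LinearMap.comp_apply]
      induction coact p with
      | zero => simp
      | add t t' h1 h2 => simp only [map_add, TensorProduct.add_tmul, add_mul, h1, h2]
      | tmul u v => simp [WA.εs_mul hA, mul_assoc]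
  rw [hr, hl]
  change WH.conv (WH.conv (act.flip 1) θ) (WA.εs ∘ₗ act.flip 1) h = _
  rw [WH.conv_assoc, WH.conv_comm hCP.cocomm hA θ, ← WH.conv_assoc, hCP.conv_act_one]

end WeakSmash
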